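/- Let Q₀, Q₁ ∈ ℂ[z₀,…,z₄] be homogeneous quadrics such that the cubic E₀ = z₀·Q₀ + z₁·Q₁ + z₂²·z₃ is smooth, and set C_i(z₂,z₃,z₄) = Q_i(0,0,z₂,z₃,z₄) for i = 0,1. Then the quadratic form z₂·z₃ is not a ℂ-linear combination of C₀, C₁ and z₂²; i.e. z₂·z₃ ∉ span_ℂ{C₀, C₁, z₂²} in ℂ[z₂,z₃,z₄]₂. -/

import Mathlib

open MvPolynomial Module

noncomputable section

/-- `E` is a smooth cubic: it is homogeneous of degree 3 and the only common zero of its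
partial derivatives is the origin. -/
def IsSmoothCubic (E : MvPolynomial (Fin 5) ℂ) : Prop :=
  E.IsHomogeneous 3 ∧ ∀ x : Fin 5 → ℂ, (∀ i, eval x (pderiv i E) = 0) → x = 0

/-- Reduction modulo `z₀, z₁`, sending `z₂, z₃, z₄` to the three variables of
`ℂ[z₂,z₃,z₄]` (realized as `MvPolynomial (Fin 3) ℂ`). -/
def red : MvPolynomial (Fin 5) ℂ →ₐ[ℂ] MvPolynomial (Fin 3) ℂ :=
  aeval ![0, 0, X 0, X 1, X 2]

theorem eval_smul_of_isHomogeneous {σ R : Type*} [CommSemiring R] {p : MvPolynomial σ R}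
    {n : ℕ} (hp : p.IsHomogeneous n) (r : R) (x : σ → R) :
    eval (r • x) p = r ^ n * eval x p := by
  rw [eval_eq, eval_eq, Finset.mul_sum]
  refine Finset.sum_congr rfl fun d hd => ?_
  have hd' : ∑ i ∈ d.support, d i = n := by
    rw [← hp (mem_support_iff.1 hd), Finsupp.weight_apply]
    simp [Finsupp.sum]
  simp only [Pi.smul_apply, smul_eq_mul, mul_pow, Finset.prod_mul_distrib,
    Finset.prod_pow_eq_pow_sum, hd']
  ring

/-- A form of positive degree over an algebraically closed field has a zero on every
projective line. -/
theorem exists_eval_smul_add_smul_eq_zero {σ k : Type*} [Field k]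
    [IsAlgClosed k] {p : MvPolynomial σ k} {n : ℕ} (hp : p.IsHomogeneous n) (hn : n ≠ 0)
    (v w : σ → k) :
    ∃ b c : k, (b ≠ 0 ∨ c ≠ 0) ∧ eval (b • v + c • w) p = 0 := by
  have hline (v w : σ → k) : ∃ F : Polynomial k, ∀ t, F.eval t = eval (t • v + w) p := by
    refine ⟨aeval (fun i => Polynomial.X * Polynomial.C (v i) + Polynomial.C (w i)) p,
      fun t => ?_⟩
    rw [← Polynomial.coe_evalRingHom, aeval_def, hom_eval₂]
    have : (Polynomial.evalRingHom t).comp (algebraMap k (Polynomial k)) = RingHom.id k := by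
      ext; simp
    rw [this, eval₂_id]
    congr 2
    ext i
    simpa using mul_comm _ _
  obtain ⟨F, hF⟩ := hline v w
  obtain ⟨G, hG⟩ := hline w v
  by_cases hdeg : F.degree = 0
  · obtain ⟨a, ha⟩ : ∃ a, F = Polynomial.C a := ⟨_, Polynomial.eq_C_of_degree_eq_zero hdeg⟩
    have hGF : Polynomial.X * G = Polynomial.X * (Polynomial.C a * Polynomial.X ^ n) := by
      refine Polynomial.funext fun s => ?_
      rcases eq_or_ne s 0 with rfl | hs
      · simp
      have h : s • w + v = s • (s⁻¹ • v + w) := by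
        rw [smul_add, smul_inv_smul₀ hs, add_comm]
      have hs' := hF s⁻¹
      rw [ha, Polynomial.eval_C] at hs'
      simp only [Polynomial.eval_mul, Polynomial.eval_X, hG, h, eval_smul_of_isHomogeneous hp, ← hs',
        Polynomial.eval_C, Polynomial.eval_pow]
      ring
    have hG0 := hG 0
    rw [mul_left_cancel₀ Polynomial.X_ne_zero hGF] at hG0
    refine ⟨1, 0, by simp, ?_⟩
    simpa [hn] using hG0.symm
  · obtain ⟨t, ht⟩ := IsAlgClosed.exists_root F hdeg
    exact ⟨t, 1, by simp, by rw [one_smul, ← hF]; exact ht⟩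

/-- If `E₀ = z₀Q₀ + z₁Q₁ + z₂²z₃` is smooth, then `z₂z₃` is not a linear combination of
`C₀ = Q₀(0,0,z₂,z₃,z₄)`, `C₁ = Q₁(0,0,z₂,z₃,z₄)` and `z₂²` in `ℂ[z₂,z₃,z₄]₂`. -/
theorem statement17 (Q₀ Q₁ : MvPolynomial (Fin 5) ℂ)
    (hQ₀ : Q₀.IsHomogeneous 2) (hQ₁ : Q₁.IsHomogeneous 2)
    (hsm : IsSmoothCubic (X 0 * Q₀ + X 1 * Q₁ + X 2 ^ 2 * X 3)) :
    (X 0 * X 1 : MvPolynomial (Fin 3) ℂ) ∉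
      Submodule.span ℂ ({red Q₀, red Q₁, X 0 ^ 2} : Set (MvPolynomial (Fin 3) ℂ)) := by
  intro hmem
  obtain ⟨α, β, γ, h⟩ := Submodule.mem_span_triple.1 hmem
  have hred (Q : MvPolynomial (Fin 5) ℂ) (b c : ℂ) :
      eval ![0, b, c] (red Q) = eval ![0, 0, 0, b, c] Q := by
    rw [red, aeval_def, hom_eval₂]
    have : (eval ![0, b, c]).comp (algebraMap ℂ (MvPolynomial (Fin 3) ℂ)) = RingHom.id ℂ := by
      ext; simp
    rw [this, eval₂_id]
    congr 2
    ext i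
    fin_cases i <;> simp
  have hcomb (b c : ℂ) :
      α * eval ![0, 0, 0, b, c] Q₀ + β * eval ![0, 0, 0, b, c] Q₁ = 0 := by
    simpa [smul_eval, hred] using congrArg (eval ![0, b, c]) h
  have hsing (b c : ℂ) (h₀ : eval ![0, 0, 0, b, c] Q₀ = 0)
      (h₁ : eval ![0, 0, 0, b, c] Q₁ = 0) : b = 0 ∧ c = 0 := by
    have hx := hsm.2 ![0, 0, 0, b, c] fun i => by
      fin_cases i <;> simp [Derivation.leibniz, Derivation.leibniz_pow, h₀, h₁]
    exact ⟨by simpa using congrFun hx 3, by simpa using congrFun hx 4⟩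
  have hzero {Q : MvPolynomial (Fin 5) ℂ} (hQ : Q.IsHomogeneous 2) :
      ∃ b c : ℂ, (b ≠ 0 ∨ c ≠ 0) ∧ eval ![0, 0, 0, b, c] Q = 0 := by
    simpa using exists_eval_smul_add_smul_eq_zero hQ two_ne_zero ![0, 0, 0, 1, 0] ![0, 0, 0, 0, 1]
  have hα : α = 0 := by
    by_contra hα
    obtain ⟨b, c, hbc, h₁⟩ := hzero hQ₁
    obtain ⟨rfl, rfl⟩ := hsing b c (by simpa [h₁, hα] using hcomb b c) h₁
    simp at hbc
  have hβ : β = 0 := by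
    by_contra hβ
    obtain ⟨b, c, hbc, h₀⟩ := hzero hQ₀
    obtain ⟨rfl, rfl⟩ := hsing b c h₀ (by simpa [h₀, hβ] using hcomb b c)
    simp at hbc
  subst hα hβ
  have h10 := congrArg (eval ![1, 0, 0]) h
  have h11 := congrArg (eval ![1, 1, 0]) h
  simp [smul_eval] at h10 h11
  simp [h10] at h11
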